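/- arXiv:1001.2942 — 5 statements merged into one kernel-verified Lean document; each statement's English description precedes it below -/
import Mathlib

section
/- For every n ≥ 3, the nonlinearity of F_3^n equals its weight: N_{F_3^n} = wt(F_3^n). -/
/-- Dot product on `F_2^n`. -/
def dotp (n : ℕ) (c x : Fin n → ZMod 2) : ZMod 2 := ∑ i, c i * x i

/-- Fourier transform of a Boolean function `f : F_2^n → F_2` at `c ∈ F_2^n`. -/
def walsh (n : ℕ) (f : (Fin n → ZMod 2) → ZMod 2) (c : Fin n → ZMod 2) : ℤ :=
  ∑ x : Fin n → ZMod 2, (-1 : ℤ) ^ (f x + dotp n c x).val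

/-- The rotation symmetric function `F_3^n(x) = Σ_i x_i x_{i+1 mod n} x_{i+2 mod n}`. -/
def F3 (n : ℕ) (x : Fin n → ZMod 2) : ZMod 2 :=
  ∑ i : Fin n, x i * x ⟨(i.val + 1) % n, Nat.mod_lt _ i.pos⟩
    * x ⟨(i.val + 2) % n, Nat.mod_lt _ i.pos⟩

/-- `t_m(x) = Σ_{i=0}^{m-3} x_i x_{i+1} x_{i+2}`. -/
def tm (m : ℕ) (x : Fin m → ZMod 2) : ZMod 2 :=
  ∑ i ∈ Finset.range m,
    if h : i + 2 < m then x ⟨i, by omega⟩ * x ⟨i + 1, by omega⟩ * x ⟨i + 2, by omega⟩ else 0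

/-- `f_0^m = t_m`. -/
def f0 (m : ℕ) (x : Fin m → ZMod 2) : ZMod 2 := tm m x

/-- `f_1^m = t_m + x_0 x_1`. -/
def f1 (m : ℕ) (x : Fin m → ZMod 2) : ZMod 2 :=
  if h : 2 ≤ m then tm m x + x ⟨0, by omega⟩ * x ⟨1, by omega⟩ else 0

/-- `f_2^m = t_m + x_{m-2} x_{m-1}`. -/
def f2 (m : ℕ) (x : Fin m → ZMod 2) : ZMod 2 :=
  if h : 2 ≤ m then tm m x + x ⟨m - 2, by omega⟩ * x ⟨m - 1, by omega⟩ else 0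

/-- `f_3^m = t_m + x_0 x_1 + x_{m-2} x_{m-1} + x_0 + x_{m-1}`. -/
def f3 (m : ℕ) (x : Fin m → ZMod 2) : ZMod 2 :=
  if h : 2 ≤ m then
    tm m x + x ⟨0, by omega⟩ * x ⟨1, by omega⟩ + x ⟨m - 2, by omega⟩ * x ⟨m - 1, by omega⟩
      + x ⟨0, by omega⟩ + x ⟨m - 1, by omega⟩
  else 0

/-- `c^m`: the vector of the first `m` coordinates of `c ∈ F_2^n`. -/
def trunc {n : ℕ} (m : ℕ) (h : m ≤ n) (c : Fin n → ZMod 2) : Fin m → ZMod 2 :=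
  fun i => c (Fin.castLE h i)

/-- `e_1 = (1,0,…,0) ∈ F_2^m`. -/
def eOne (m : ℕ) : Fin m → ZMod 2 := fun i => if i.val = 0 then 1 else 0

/-- `e_{2^{m-1}} = (0,…,0,1) ∈ F_2^m`. -/
def eLast (m : ℕ) : Fin m → ZMod 2 := fun i => if i.val = m - 1 then 1 else 0

/-- The weight of a Boolean function: the number of `x` with `f x = 1`. -/
def wt (n : ℕ) (f : (Fin n → ZMod 2) → ZMod 2) : ℕ :=
  (Finset.univ.filter fun x => f x = 1).card

/-- The sign character `a ↦ (-1)^a` of `F_2`. -/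
def signChar (a : ZMod 2) : ℤ := (-1) ^ a.val

lemma signChar_add (a b : ZMod 2) : signChar (a + b) = signChar a * signChar b := by
  revert a b; decide

/-! ### Transfer matrices -/

/-- The transfer matrix on pairs of consecutive coordinates. -/
def transfer (c : ZMod 2) : Matrix (ZMod 2 × ZMod 2) (ZMod 2 × ZMod 2) ℤ :=
  fun p q => if p.2 = q.1 then signChar (p.1 * p.2 * q.2 + c * q.2) else 0

lemma sum_pi_succ {m : ℕ} (g : (Fin (m + 1) → ZMod 2) → ℤ) :
    ∑ y, g y = ∑ z : ZMod 2, ∑ y : Fin m → ZMod 2, g (Fin.cons z y) := by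
  rw [← Fintype.sum_prod_type']
  exact (Fintype.sum_equiv (Fin.consEquiv fun _ => ZMod 2) _ _ fun _ => rfl).symm

lemma transfer_mulVec (c : ZMod 2) (f : ZMod 2 × ZMod 2 → ℤ) (a b : ZMod 2) :
    (transfer c).mulVec f (a, b) = ∑ z, signChar (a * b * z + c * z) * f (b, z) := by
  simp only [Matrix.mulVec, dotProduct, transfer, Fintype.sum_prod_type, ite_mul, zero_mul]
  rw [Finset.sum_comm]
  simp

lemma sum_chain (m : ℕ) (c : Fin m → ZMod 2) (f : ZMod 2 × ZMod 2 → ℤ) (a b : ZMod 2) :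
    ∑ y : Fin m → ZMod 2, (let x : Fin (m + 2) → ZMod 2 := Fin.cons a (Fin.cons b y)
      signChar (∑ i : Fin m, (x i.castSucc.castSucc * x i.succ.castSucc * x i.succ.succ + c i * y i))
        * f (x (Fin.last m).castSucc, x (Fin.last (m + 1))))
      = ((List.ofFn c).map transfer).prod.mulVec f (a, b) := by
  induction m generalizing a b with
  | zero => simp [signChar, show Fin.last 1 = Fin.succ 0 from rfl]
  | succ m ih =>
    rw [List.ofFn_succ, List.map_cons, List.prod_cons, ← Matrix.mulVec_mulVec, transfer_mulVec,
      sum_pi_succ]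
    refine Finset.sum_congr rfl fun z _ => ?_
    rw [← ih, Finset.mul_sum]
    refine Finset.sum_congr rfl fun y _ => ?_
    simp only [Fin.sum_univ_succ (n := m), ← Fin.succ_last, ← Fin.succ_castSucc, Fin.cons_succ,
      Fin.cons_zero, Fin.castSucc_zero, signChar_add, mul_assoc]

lemma F3_cons_cons (m : ℕ) (a b : ZMod 2) (y : Fin m → ZMod 2) :
    (let x : Fin (m + 2) → ZMod 2 := Fin.cons a (Fin.cons b y)
     F3 (m + 2) x = ∑ i : Fin m, x i.castSucc.castSucc * x i.succ.castSucc * x i.succ.succ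
        + x (Fin.last m).castSucc * x (Fin.last (m + 1)) * a + x (Fin.last (m + 1)) * a * b) := by
  intro x
  have ha : x 0 = a := rfl
  have hb : x 1 = b := rfl
  rw [F3, Fin.sum_univ_castSucc, Fin.sum_univ_castSucc, ← ha, ← hb]
  have hm (i : ℕ) (hi : i < m + 2) (h : (i % (m + 2)) < m + 2) :
      (⟨i % (m + 2), h⟩ : Fin (m + 2)) = ⟨i, hi⟩ := Fin.ext (Nat.mod_eq_of_lt hi)
  have h0 (h : (m + 2) % (m + 2) < m + 2) : (⟨(m + 2) % (m + 2), h⟩ : Fin (m + 2)) = 0 :=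
    Fin.ext (Nat.mod_self _)
  have h1 (h : (m + 3) % (m + 2) < m + 2) : (⟨(m + 3) % (m + 2), h⟩ : Fin (m + 2)) = 1 :=
    Fin.ext (by simp [show m + 3 = 1 + (m + 2) by ring])
  congr 2
  · refine Finset.sum_congr rfl fun i _ => ?_
    simp only [Fin.val_castSucc]
    rw [hm _ (by omega), hm _ (by omega)]
    rfl
  · simp only [Fin.val_castSucc, Fin.val_last]
    rw [hm _ (by omega), h0]
    rfl
  · simp only [Fin.val_last]
    rw [h0]
  · exact congrArg x (h1 _)

lemma walsh_F3_eq_trace (m : ℕ) (a b : ZMod 2) (c : Fin m → ZMod 2) :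
    walsh (m + 2) (F3 (m + 2)) (Fin.cons a (Fin.cons b c))
      = (((List.ofFn c ++ [a, b]).map transfer).prod).trace := by
  rw [walsh, sum_pi_succ]
  simp only [sum_pi_succ (m := m), Matrix.trace, Matrix.diag, Fintype.sum_prod_type]
  refine Finset.sum_congr rfl fun u _ => Finset.sum_congr rfl fun v _ => ?_
  rw [List.map_append, List.prod_append]
  change _ = Matrix.mulVec _ (fun p => ([a, b].map transfer).prod p (u, v)) (u, v)
  rw [← sum_chain]
  refine Finset.sum_congr rfl fun y _ => ?_
  have hF := F3_cons_cons m u v y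
  have hT (p : ZMod 2 × ZMod 2) : ([a, b].map transfer).prod p (u, v)
      = signChar (p.1 * p.2 * u + a * u + p.2 * u * v + b * v) := by
    obtain ⟨p, q⟩ := p
    simp [Matrix.mul_apply, transfer, Fintype.sum_prod_type, ← signChar_add, ← add_assoc]
  simp only at hF ⊢
  rw [hF, hT, ← signChar_add, signChar]
  simp only [dotp, Fin.sum_univ_succ (n := m + 1), Fin.sum_univ_succ (n := m), Fin.cons_zero,
    Fin.cons_succ, Finset.sum_add_distrib]
  congr 2
  ring

/-- The transfer matrix after merging the states `(0, 0)` and `(1, 0)`. -/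
def reduced (c : ZMod 2) : Matrix (Fin 3) (Fin 3) ℤ :=
  !![1, signChar c, 0; 1, 0, signChar c; 1, 0, -signChar c]

/-- The map merging the states `(0, 0)` and `(1, 0)`. -/
def merge : Matrix (ZMod 2 × ZMod 2) (Fin 3) ℤ :=
  fun p i => if p.2 = 0 then ![1, 0, 0] i else if p.1 = 0 then ![0, 1, 0] i else ![0, 0, 1] i

/-- The transitions out of the merged states. -/
def exits (c : ZMod 2) : Matrix (Fin 3) (ZMod 2 × ZMod 2) ℤ :=
  fun i p => transfer c (![(0, 0), (0, 1), (1, 1)] i) p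

lemma merge_mul_exits (c : ZMod 2) : merge * exits c = transfer c := by
  ext ⟨p, q⟩ ⟨u, v⟩
  revert c p q u v
  decide

lemma exits_mul_merge (c : ZMod 2) : exits c * merge = reduced c := by
  ext i j
  revert c
  fin_cases i <;> fin_cases j <;> decide

lemma prod_transfer_concat (l : List (ZMod 2)) (c : ZMod 2) :
    ((l ++ [c]).map transfer).prod = merge * (l.map reduced).prod * exits c := by
  induction l with
  | nil => simp [merge_mul_exits]
  | cons d l ih =>
    rw [List.cons_append, List.map_cons, List.prod_cons, ih, List.map_cons, List.prod_cons,
      ← merge_mul_exits, ← exits_mul_merge]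
    simp only [Matrix.mul_assoc]

lemma trace_prod_transfer (l : List (ZMod 2)) (hl : l ≠ []) :
    ((l.map transfer).prod).trace = ((l.map reduced).prod).trace := by
  obtain ⟨l, c, rfl⟩ := List.eq_nil_or_concat l |>.resolve_left hl
  rw [List.concat_eq_append, prod_transfer_concat, Matrix.mul_assoc, Matrix.trace_mul_comm,
    Matrix.mul_assoc, exits_mul_merge]
  simp

/-! ### Dominated vectors -/

/-- The cone of reference vectors, which is preserved by `reduced 0`. -/
structure IsRef (R : Fin 3 → ℤ) : Prop where
  nonneg₀ : 0 ≤ R 0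
  nonneg₁ : 0 ≤ R 1
  nonneg₂ : 0 ≤ R 2
  two_mul_le : 2 * R 2 ≤ R 0
  le_add : R 0 ≤ R 1 + 2 * R 2
  add_le : R 1 + R 2 ≤ 2 * R 0

/-- A family of inequalities between `p` and the reference vector `R` which is inherited by
`reduced c *ᵥ p` and `reduced 0 *ᵥ R` for every `c`. -/
def Dominated (p R : Fin 3 → ℤ) : Prop :=
  |p 0| ≤ R 0 ∧ |p 1| ≤ R 1 ∧ |p 0| + |p 2| ≤ R 0 + R 2 ∧
    |2 * p 0 + p 1 - p 2| ≤ 2 * R 0 + R 1 - R 2 ∧ |2 * p 0 - p 1 + p 2| ≤ 2 * R 0 + R 1 - R 2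

instance (p R : Fin 3 → ℤ) : Decidable (Dominated p R) := by unfold Dominated; infer_instance

lemma reduced_mulVec (c : ZMod 2) (p : Fin 3 → ℤ) : (reduced c).mulVec p =
    ![p 0 + signChar c * p 1, p 0 + signChar c * p 2, p 0 - signChar c * p 2] := by
  ext i
  fin_cases i <;> simp [reduced, Matrix.mulVec, dotProduct, Fin.sum_univ_three, sub_eq_add_neg]

lemma signChar_eq (c : ZMod 2) : signChar c = 1 ∨ signChar c = -1 := by
  revert c; decide

lemma IsRef.reduced_zero {R : Fin 3 → ℤ} (hR : IsRef R) : IsRef ((reduced 0).mulVec R) := by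
  obtain ⟨h0, h1, h2, h3, h4, h5⟩ := hR
  rw [reduced_mulVec]
  constructor <;> simp [signChar] <;> omega

lemma Dominated.step {p R : Fin 3 → ℤ} (h : Dominated p R) (hR : IsRef R) (c : ZMod 2) :
    Dominated ((reduced c).mulVec p) ((reduced 0).mulVec R) := by
  obtain ⟨h0, h1, h2, h3, h4, h5⟩ := hR
  rw [reduced_mulVec, reduced_mulVec]
  simp only [Dominated] at h ⊢
  rcases signChar_eq c with hc | hc <;> rw [hc, show signChar 0 = 1 from rfl] <;>
    simp only [abs_eq_max_neg, Matrix.cons_val, one_mul, neg_mul, sub_neg_eq_add] at h ⊢ <;>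
    refine ⟨?_, ?_, ?_, ?_, ?_⟩ <;> omega

lemma IsRef.pow {R : Fin 3 → ℤ} (hR : IsRef R) (m : ℕ) :
    IsRef ((reduced 0 ^ m).mulVec R) := by
  induction m with
  | zero => simpa using hR
  | succ m ih => rw [pow_succ', ← Matrix.mulVec_mulVec]; exact ih.reduced_zero

lemma Dominated.prod {p R : Fin 3 → ℤ} (h : Dominated p R) (hR : IsRef R) (l : List (ZMod 2)) :
    Dominated ((l.map reduced).prod.mulVec p) ((reduced 0 ^ l.length).mulVec R) := by
  induction l with
  | nil => simpa using h
  | cons c l ih =>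
    rw [List.map_cons, List.prod_cons, List.length_cons, pow_succ', ← Matrix.mulVec_mulVec,
      ← Matrix.mulVec_mulVec]
    exact ih.step (hR.pow _) c

/-! ### Comparison of traces -/

/-- The difference between the trace of `A * reduced 0 ^ 6` and the upper bound obtained from the
reference vectors `(8, 8, 4)`, `(6, 4, 2)` and `(8, 8, 4)`. -/
def gap (A : Matrix (Fin 3) (Fin 3) ℤ) : ℤ :=
  (A * reduced 0 ^ 6).trace - (A.mulVec ![8, 8, 4] 0 + A.mulVec ![6, 4, 2] 1
    + (A.mulVec ![8, 8, 4] 0 + A.mulVec ![8, 8, 4] 2))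

lemma reduced_zero_pow_three : reduced 0 ^ 3 = (2 : ℤ) • reduced 0 + (2 : ℤ) • 1 := by
  rw [pow_three]; decide

lemma gap_nonneg (m : ℕ) : 0 ≤ gap (reduced 0 ^ m) := by
  suffices h : 0 ≤ gap (reduced 0 ^ m) ∧ 0 ≤ gap (reduced 0 ^ (m + 1)) ∧
      0 ≤ gap (reduced 0 ^ (m + 2)) from h.1
  induction m with
  | zero => refine ⟨?_, ?_, ?_⟩ <;> simp only [gap, pow_succ, pow_zero, one_mul] <;> decide
  | succ m ih =>
    refine ⟨ih.2.1, ih.2.2, ?_⟩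
    have hrec : gap (reduced 0 ^ (m + 1 + 2))
        = 2 * gap (reduced 0 ^ (m + 1)) + 2 * gap (reduced 0 ^ m) := by
      rw [show m + 1 + 2 = m + 3 by ring, pow_add, reduced_zero_pow_three, mul_add, mul_smul_comm,
        mul_smul_comm, ← pow_succ, mul_one]
      simp only [gap, add_mul, smul_mul_assoc, Matrix.trace_add, Matrix.trace_smul,
        Matrix.add_mulVec, Matrix.smul_mulVec, Pi.add_apply, Pi.smul_apply, smul_eq_mul]
      ring
    rw [hrec]
    linarith [ih.1, ih.2.1]

lemma dominated_columns : ∀ a b c d e : ZMod 2,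
    Dominated (fun i => ([a, b, c, 1, d, e].map reduced).prod i 0) ![8, 8, 4] ∧
    Dominated (fun i => ([a, b, c, 1, d, e].map reduced).prod i 1) ![6, 4, 2] ∧
    Dominated (fun i => ([a, b, c, 1, d, e].map reduced).prod i 2) ![8, 8, 4] := by
  decide +kernel

lemma trace_le_of_window (l : List (ZMod 2)) (a b c d e : ZMod 2) :
    (((l ++ [a, b, c, 1, d, e]).map reduced).prod).trace ≤ (reduced 0 ^ (l.length + 6)).trace := by
  obtain ⟨h0, h1, h2⟩ := dominated_columns a b c d e
  have hR : IsRef ![8, 8, 4] := by constructor <;> decide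
  have hS : IsRef ![6, 4, 2] := by constructor <;> decide
  have h0 := h0.prod hR l
  have h1 := h1.prod hS l
  have h2 := h2.prod hR l
  have hg := gap_nonneg l.length
  rw [gap, ← pow_add] at hg
  rw [List.map_append, List.prod_append, Matrix.trace_fin_three]
  change Matrix.mulVec _ _ 0 + Matrix.mulVec _ _ 1 + Matrix.mulVec _ _ 2 ≤ _
  have k0 := (abs_le.1 h0.1).2
  have k1 := (abs_le.1 h1.2.1).2
  have k2 := h2.2.2.1
  have k3 := le_abs_self (((l.map reduced).prod.mulVec
    fun i => ([a, b, c, 1, d, e].map reduced).prod i 2) 2)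
  have k4 := abs_nonneg (((l.map reduced).prod.mulVec
    fun i => ([a, b, c, 1, d, e].map reduced).prod i 2) 0)
  linarith

lemma trace_prod_rotate {l l' : List (ZMod 2)} (h : l ~r l') :
    ((l.map reduced).prod).trace = ((l'.map reduced).prod).trace := by
  obtain ⟨k, rfl⟩ := h
  induction k generalizing l with
  | zero => simp
  | succ k ih =>
    cases l with
    | nil => simp
    | cons c l =>
      rw [List.rotate_cons_succ, ← ih, List.map_cons, List.prod_cons, List.map_append,
        List.prod_append, Matrix.trace_mul_comm]
      simp

lemma trace_prod_le (l : List (ZMod 2)) (hl : 3 ≤ l.length) :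
    ((l.map reduced).prod).trace ≤ (reduced 0 ^ l.length).trace := by
  have base3 : ∀ a b c : ZMod 2,
      (([a, b, c].map reduced).prod).trace ≤ (([0, 0, 0].map reduced).prod).trace := by
    decide +kernel
  have base4 : ∀ a b c d : ZMod 2,
      (([a, b, c, d].map reduced).prod).trace ≤ (([0, 0, 0, 0].map reduced).prod).trace := by
    decide +kernel
  have base5 : ∀ a b c d e : ZMod 2,
      (([a, b, c, d, e].map reduced).prod).trace ≤ (([0, 0, 0, 0, 0].map reduced).prod).trace := by
    decide +kernel
  by_cases h1 : (1 : ZMod 2) ∈ l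
  · obtain ⟨s, t, rfl⟩ := List.append_of_mem h1
    rw [trace_prod_rotate (List.isRotated_append : s ++ 1 :: t ~r _)]
    have hlen : (s ++ 1 :: t).length = (t ++ s).length + 1 := by simp; omega
    rw [hlen] at hl ⊢
    rw [List.cons_append]
    generalize t ++ s = u at hl ⊢
    match u, hl with
    | [a, b], _ => exact base3 1 a b
    | [a, b, c], _ => exact base4 1 a b c
    | [a, b, c, d], _ => exact base5 1 a b c d
    | d :: e :: a :: b :: c :: v, _ =>
      obtain ⟨v', a', b', c', hv⟩ : ∃ v' a' b' c', a :: b :: c :: v = v' ++ [a', b', c'] := by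
        refine ⟨(a :: b :: c :: v).take v.length, ?_⟩
        have hd : ((a :: b :: c :: v).drop v.length).length = 3 := by simp; omega
        obtain ⟨a', b', c', hd⟩ := List.length_eq_three.1 hd
        exact ⟨a', b', c', by rw [← hd, List.take_append_drop]⟩
      have hr : 1 :: d :: e :: (v' ++ [a', b', c']) ~r v' ++ [a', b', c', 1, d, e] := by
        simpa using (List.isRotated_append :
          [1, d, e] ++ (v' ++ [a', b', c']) ~r (v' ++ [a', b', c']) ++ [1, d, e])
      rw [hv, trace_prod_rotate hr]
      refine (trace_le_of_window v' a' b' c' d e).trans_eq ?_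
      simp only [List.length_cons, List.length_append, List.length_nil]
  · have hz : l = List.replicate l.length 0 := by
      refine List.eq_replicate_iff.2 ⟨rfl, fun b hb => ?_⟩
      have : ∀ b : ZMod 2, b ≠ 1 → b = 0 := by decide
      exact this b fun h => h1 (h ▸ hb)
    conv_lhs => rw [hz]
    simp

/-! ### The nonlinearity -/

lemma walsh_F3_le (n : ℕ) (hn : 3 ≤ n) (c : Fin n → ZMod 2) :
    walsh n (F3 n) c ≤ walsh n (F3 n) 0 := by
  have key (m : ℕ) (c : Fin (m + 2) → ZMod 2) : ∃ l : List (ZMod 2), l.length = m + 2 ∧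
      (c = 0 → l = List.replicate (m + 2) 0) ∧
      walsh (m + 2) (F3 (m + 2)) c = ((l.map reduced).prod).trace := by
    refine ⟨List.ofFn (Fin.tail (Fin.tail c)) ++ [c 0, c 1], by simp, ?_, ?_⟩
    · rintro rfl
      refine List.eq_replicate_iff.2 ⟨by simp, ?_⟩
      simp +contextual [Fin.tail, List.mem_ofFn, or_imp, eq_comm]
    · rw [← trace_prod_transfer _ (by simp), ← walsh_F3_eq_trace]
      congr 1
      rw [show c 1 = Fin.tail c 0 from rfl, Fin.cons_self_tail, Fin.cons_self_tail]
  obtain ⟨m, rfl⟩ : ∃ m, n = m + 2 := ⟨n - 2, by omega⟩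
  obtain ⟨l, hl, -, h⟩ := key m c
  obtain ⟨l', -, hl', h'⟩ := key m 0
  rw [h, h', hl' rfl]
  simpa [hl] using trace_prod_le l (hl.symm ▸ hn)

lemma two_mul_wt (n : ℕ) (f : (Fin n → ZMod 2) → ZMod 2) (c : Fin n → ZMod 2) :
    2 * (wt n fun x => f x + dotp n c x : ℤ) = 2 ^ n - walsh n f c := by
  have hs : ∀ a : ZMod 2, (-1 : ℤ) ^ a.val = 1 - 2 * (if a = 1 then 1 else 0) := by decide
  simp only [wt, walsh, hs, Finset.sum_sub_distrib, ← Finset.mul_sum]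
  simp

/-- For every `n ≥ 3`, the nonlinearity of `F_3^n`
(the minimum over `c` of the distance `wt (F_3^n + c·x)` to the linear function `ℓ_c`)
equals its weight. -/
theorem stmt_1 (n : ℕ) (hn : 3 ≤ n) :
    Finset.univ.inf' Finset.univ_nonempty
        (fun c : Fin n → ZMod 2 => wt n fun x => F3 n x + dotp n c x)
      = wt n (F3 n) := by
  have h0 : (fun x => F3 n x + dotp n 0 x) = F3 n := by
    funext x
    simp [dotp]
  refine le_antisymm ?_ (Finset.le_inf' _ _ fun c _ => ?_)
  · refine (Finset.inf'_le _ (Finset.mem_univ 0)).trans_eq ?_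
    rw [h0]
  · have h1 := two_mul_wt n (F3 n) c
    have h2 := two_mul_wt n (F3 n) 0
    rw [h0] at h2
    have h3 := walsh_F3_le n hn c
    exact_mod_cast (by linarith : (wt n (F3 n) : ℤ) ≤ wt n fun x => F3 n x + dotp n c x)
end

section
/- For every n ≥ 5 and every c = (c_0,…,c_{n−1}) ∈ F_2^n, splitting the sum over the last two coordinates gives F̂_3^n(c) = f̂_0^{n−2}(c^{n−2}) + (−1)^{c_{n−2}} · f̂_2^{n−2}(c^{n−2}) + (−1)^{c_{n−1}} · f̂_1^{n−2}(c^{n−2}) + (−1)^{c_{n−2}+c_{n−1}} · f̂_3^{n−2}(c^{n−2}), where c^{n−2} = (c_0,…,c_{n−3}) ∈ F_2^{n−2} is the vector of the first n−2 coordinates of c. -/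
theorem F3_add_four (k : ℕ) (x : Fin (k + 4) → ZMod 2) :
    F3 (k + 4) x = tm (k + 2) (fun i => x i.castSucc.castSucc)
      + x ⟨k, by omega⟩ * x ⟨k + 1, by omega⟩ * x ⟨k + 2, by omega⟩
      + x ⟨k + 1, by omega⟩ * x ⟨k + 2, by omega⟩ * x ⟨k + 3, by omega⟩
      + x ⟨k + 2, by omega⟩ * x ⟨k + 3, by omega⟩ * x ⟨0, by omega⟩
      + x ⟨k + 3, by omega⟩ * x ⟨0, by omega⟩ * x ⟨1, by omega⟩ := by
  have hmod (a : ℕ) (h : a < k + 4) : a % (k + 4) = a := Nat.mod_eq_of_lt h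
  have h4 : (k + 2 + 2) % (k + 4) = 0 := Nat.mod_self _
  have h4' : (k + 3 + 1) % (k + 4) = 0 := Nat.mod_self _
  have h5 : (k + 3 + 2) % (k + 4) = 1 := by
    rw [show k + 3 + 2 = 1 + (k + 4) by omega, Nat.add_mod_right, hmod 1 (by omega)]
  have htm : tm (k + 2) (fun i => x i.castSucc.castSucc)
      = ∑ i : Fin k, x ⟨i, by omega⟩ * x ⟨i + 1, by omega⟩ * x ⟨i + 2, by omega⟩ := by
    rw [tm, Finset.sum_range_succ, Finset.sum_range_succ, dif_neg (by omega),
      dif_neg (by omega), add_zero, add_zero, Finset.sum_range]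
    refine Finset.sum_congr rfl fun i _ => ?_
    rw [dif_pos (by omega)]
    rfl
  rw [F3, Fin.sum_univ_castSucc, Fin.sum_univ_castSucc, Fin.sum_univ_castSucc,
    Fin.sum_univ_castSucc, htm]
  congr 1
  · congr 1
    · congr 1
      · congr 1
        · refine Finset.sum_congr rfl fun i _ => ?_
          simp only [Fin.val_castSucc, hmod (i + 1) (by omega), hmod (i + 2) (by omega)]
          rfl
        · simp only [Fin.val_castSucc, Fin.val_last, hmod (k + 1) (by omega),
            hmod (k + 2) (by omega)]
          rfl
      · simp only [Fin.val_castSucc, Fin.val_last, hmod (k + 1 + 1) (by omega),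
          hmod (k + 1 + 2) (by omega)]
        rfl
    · simp only [Fin.val_castSucc, Fin.val_last, hmod (k + 2 + 1) (by omega), h4]
      rfl
  · simp only [Fin.val_last, h4', h5]
    rfl

/-- `F3` with its last two coordinates split off. -/
theorem F3_snoc_snoc (k : ℕ) (y : Fin (k + 2) → ZMod 2) (u v : ZMod 2) :
    F3 (k + 4) (Fin.snoc (α := fun _ => ZMod 2) (Fin.snoc (α := fun _ => ZMod 2) y u) v)
      = tm (k + 2) y + y ⟨k, by omega⟩ * y ⟨k + 1, by omega⟩ * u
        + y ⟨k + 1, by omega⟩ * u * v + u * v * y ⟨0, by omega⟩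
        + v * y ⟨0, by omega⟩ * y ⟨1, by omega⟩ := by
  have hy (i : ℕ) (h : i < k + 2) :
      Fin.snoc (α := fun _ => ZMod 2) (Fin.snoc (α := fun _ => ZMod 2) y u) v
        (⟨i, by omega⟩ : Fin (k + 4)) = y ⟨i, h⟩ := by
    rw [show (⟨i, by omega⟩ : Fin (k + 4)) = (⟨i, h⟩ : Fin (k + 2)).castSucc.castSucc from rfl,
      Fin.snoc_castSucc, Fin.snoc_castSucc]
  have hu : Fin.snoc (α := fun _ => ZMod 2) (Fin.snoc (α := fun _ => ZMod 2) y u) v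
      (⟨k + 2, by omega⟩ : Fin (k + 4)) = u := by
    rw [show (⟨k + 2, by omega⟩ : Fin (k + 4)) = (Fin.last (k + 2)).castSucc from rfl,
      Fin.snoc_castSucc, Fin.snoc_last]
  have hv : Fin.snoc (α := fun _ => ZMod 2) (Fin.snoc (α := fun _ => ZMod 2) y u) v
      (⟨k + 3, by omega⟩ : Fin (k + 4)) = v := Fin.snoc_last _ _
  rw [F3_add_four, hu, hv, hy k (by omega), hy (k + 1) (by omega), hy 0 (by omega),
    hy 1 (by omega)]
  simp only [Fin.snoc_castSucc]

theorem dotp_snoc (n : ℕ) (c : Fin (n + 1) → ZMod 2) (y : Fin n → ZMod 2) (u : ZMod 2) :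
    dotp (n + 1) c (Fin.snoc (α := fun _ => ZMod 2) y u)
      = dotp n (fun i => c i.castSucc) y + c (Fin.last n) * u := by
  simp [dotp, Fin.sum_univ_castSucc]

theorem sum_snoc (n : ℕ) (g : (Fin (n + 1) → ZMod 2) → ℤ) :
    ∑ x, g x = ∑ y : Fin n → ZMod 2, (g (Fin.snoc (α := fun _ => ZMod 2) y 0)
      + g (Fin.snoc (α := fun _ => ZMod 2) y 1)) := by
  rw [← (Fin.snocEquiv fun _ => ZMod 2).sum_comp, Fintype.sum_prod_type_right]
  exact Finset.sum_congr rfl fun y _ => Fin.sum_univ_two _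

theorem neg_one_pow_val_add (a b : ZMod 2) :
    (-1 : ℤ) ^ (a + b).val = (-1) ^ a.val * (-1) ^ b.val := by
  revert a b
  decide

theorem walsh_F3_add_four (k : ℕ) (c : Fin (k + 4) → ZMod 2) :
    walsh (k + 4) (F3 (k + 4)) c
      = walsh (k + 2) (f0 (k + 2)) (fun i => c i.castSucc.castSucc)
        + (-1 : ℤ) ^ (c (Fin.last _).castSucc).val
            * walsh (k + 2) (f2 (k + 2)) (fun i => c i.castSucc.castSucc)
        + (-1 : ℤ) ^ (c (Fin.last _)).val
            * walsh (k + 2) (f1 (k + 2)) (fun i => c i.castSucc.castSucc)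
        + (-1 : ℤ) ^ (c (Fin.last _).castSucc + c (Fin.last _)).val
            * walsh (k + 2) (f3 (k + 2)) (fun i => c i.castSucc.castSucc) := by
  simp only [walsh, sum_snoc (k + 3), sum_snoc (k + 2), F3_snoc_snoc, dotp_snoc,
    Finset.mul_sum, ← Finset.sum_add_distrib]
  refine Finset.sum_congr rfl fun y _ => ?_
  simp only [f0, f1, f2, f3, Nat.le_add_left, dif_pos, neg_one_pow_val_add, Nat.add_sub_cancel,
    Nat.add_succ_sub_one, mul_zero, mul_one, zero_mul, one_mul, add_zero]
  ring

/-- For every `n ≥ 5` and `c ∈ F_2^n`,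
`F̂_3^n(c) = f̂_0^{n−2}(c^{n−2}) + (−1)^{c_{n−2}} f̂_2^{n−2}(c^{n−2})
 + (−1)^{c_{n−1}} f̂_1^{n−2}(c^{n−2}) + (−1)^{c_{n−2}+c_{n−1}} f̂_3^{n−2}(c^{n−2})`. -/
theorem stmt_4 (n : ℕ) (hn : 5 ≤ n) (c : Fin n → ZMod 2) :
    walsh n (F3 n) c
      = walsh (n - 2) (f0 (n - 2)) (trunc (n - 2) (by omega) c)
        + (-1 : ℤ) ^ (c ⟨n - 2, by omega⟩).val
            * walsh (n - 2) (f2 (n - 2)) (trunc (n - 2) (by omega) c)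
        + (-1 : ℤ) ^ (c ⟨n - 1, by omega⟩).val
            * walsh (n - 2) (f1 (n - 2)) (trunc (n - 2) (by omega) c)
        + (-1 : ℤ) ^ (c ⟨n - 2, by omega⟩ + c ⟨n - 1, by omega⟩).val
            * walsh (n - 2) (f3 (n - 2)) (trunc (n - 2) (by omega) c) := by
  obtain ⟨k, rfl⟩ := Nat.exists_eq_add_of_le' (show 4 ≤ n by omega)
  exact walsh_F3_add_four k c
end

section
/- For every n ≥ 8 and every c = (c_0,…,c_{n−1}) ∈ F_2^n with c_{n−1} = 1: if c_{n−2} = 0 then f̂_2^n(c) = f̂_0^{n−1}(c^{n−1}) − 2(−1)^{c_{n−3}} f̂_0^{n−4}(c^{n−4}); if c_{n−2} = 1 and c_{n−3} = 0 then f̂_2^n(c) = f̂_0^{n−1}(c^{n−1}) − 2 f̂_0^{n−4}(c^{n−4}) − 4(−1)^{c_{n−4}} f̂_0^{n−5}(c^{n−5}); if c_{n−2} = 1 and c_{n−3} = 1 then f̂_2^n(c) = f̂_0^{n−1}(c^{n−1}) − 2 f̂_0^{n−4}(c^{n−4}) − 4(−1)^{c_{n−4}+c_{n−5}} f̂_2^{n−5}(c^{n−5}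 + e_{2^{n−6}}). -/
/-- Splitting the Fourier transform along the last coordinate. -/
theorem walsh_succ (m : ℕ) (f : (Fin (m + 1) → ZMod 2) → ZMod 2) (c : Fin (m + 1) → ZMod 2) :
    walsh (m + 1) f c
      = ∑ y : Fin m → ZMod 2,
          ((-1 : ℤ) ^ (f (Fin.snoc y 0) + dotp m (Fin.init c) y).val
            + (-1 : ℤ) ^ (c (Fin.last m)).val
              * (-1 : ℤ) ^ (f (Fin.snoc y 1) + dotp m (Fin.init c) y).val) := by
  have key : ∀ a b d : ZMod 2,
      (-1 : ℤ) ^ (a + (b + d)).val = (-1 : ℤ) ^ d.val * (-1 : ℤ) ^ (a + b).val := by decide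
  have univ_eq : (Finset.univ : Finset (ZMod 2)) = {0, 1} := rfl
  have dotp_snoc : ∀ (y : Fin m → ZMod 2) (a : ZMod 2),
      dotp (m + 1) c (Fin.snoc y a : Fin (m + 1) → ZMod 2)
        = dotp m (Fin.init c) y + c (Fin.last m) * a := by
    intro y a
    simp [dotp, Fin.sum_univ_castSucc, Fin.init]
  unfold walsh
  rw [← (Fin.snocEquiv fun _ : Fin (m + 1) => ZMod 2).sum_comp, Fintype.sum_prod_type_right]
  refine Finset.sum_congr rfl fun y _ => ?_
  rw [univ_eq, Finset.sum_pair zero_ne_one]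
  simp only [Fin.snocEquiv, Equiv.coe_fn_mk]
  rw [dotp_snoc, dotp_snoc, key, key]
  simp

theorem tm_snoc (k : ℕ) (y : Fin (k + 2) → ZMod 2) (a : ZMod 2) :
    tm (k + 3) (Fin.snoc y a : Fin (k + 3) → ZMod 2)
      = tm (k + 2) y + y ⟨k, by omega⟩ * y ⟨k + 1, by omega⟩ * a := by
  have snoc_lt : ∀ (i : ℕ) (hi : i < k + 2),
      (Fin.snoc y a : Fin (k + 3) → ZMod 2) ⟨i, by omega⟩ = y ⟨i, hi⟩ :=
    fun i hi => Fin.snoc_castSucc (α := fun _ => ZMod 2) a y ⟨i, hi⟩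
  have snoc_last : (Fin.snoc y a : Fin (k + 3) → ZMod 2) ⟨k + 2, by omega⟩ = a :=
    Fin.snoc_last (α := fun _ => ZMod 2) a y
  have low : ∀ i ∈ Finset.range k,
      (if h : i + 2 < k + 3 then
          (Fin.snoc y a : Fin (k + 3) → ZMod 2) ⟨i, by omega⟩
            * (Fin.snoc y a : Fin (k + 3) → ZMod 2) ⟨i + 1, by omega⟩
            * (Fin.snoc y a : Fin (k + 3) → ZMod 2) ⟨i + 2, by omega⟩
        else 0)
      = if h : i + 2 < k + 2 then
          y ⟨i, by omega⟩ * y ⟨i + 1, by omega⟩ * y ⟨i + 2, by omega⟩ else 0 := by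
    intro i hi
    have hi := Finset.mem_range.mp hi
    rw [dif_pos (by omega), dif_pos (by omega), snoc_lt i, snoc_lt (i + 1), snoc_lt (i + 2)]
  unfold tm
  simp only [Finset.sum_range_succ]
  rw [Finset.sum_congr rfl low, dif_pos (show k + 2 < k + 3 by omega),
    snoc_lt k (by omega), snoc_lt (k + 1) (by omega), snoc_last]
  simp

theorem f2_add_two (k : ℕ) (y : Fin (k + 2) → ZMod 2) :
    f2 (k + 2) y = tm (k + 2) y + y ⟨k, by omega⟩ * y ⟨k + 1, by omega⟩ :=
  dif_pos (by omega)

theorem f2_snoc (k : ℕ) (y : Fin (k + 2) → ZMod 2) (a : ZMod 2) :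
    f2 (k + 3) (Fin.snoc y a : Fin (k + 3) → ZMod 2)
      = tm (k + 2) y + y ⟨k, by omega⟩ * y ⟨k + 1, by omega⟩ * a + y ⟨k + 1, by omega⟩ * a := by
  have h1 : (Fin.snoc y a : Fin (k + 3) → ZMod 2) ⟨k + 1, by omega⟩ = y ⟨k + 1, by omega⟩ :=
    Fin.snoc_castSucc (α := fun _ => ZMod 2) a y ⟨k + 1, by omega⟩
  have h2 : (Fin.snoc y a : Fin (k + 3) → ZMod 2) ⟨k + 1 + 1, by omega⟩ = a :=
    Fin.snoc_last (α := fun _ => ZMod 2) a y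
  rw [f2_add_two (k + 1), tm_snoc, h1, h2]

theorem dotp_add_eLast (m : ℕ) (c y : Fin (m + 1) → ZMod 2) :
    dotp (m + 1) (c + eLast (m + 1)) y = dotp (m + 1) c y + y (Fin.last m) := by
  have h : ∀ i : Fin m, (i : ℕ) ≠ m := fun i => i.isLt.ne
  simp [dotp, Fin.sum_univ_castSucc, eLast, h, add_mul, add_assoc]

theorem walsh_f0_succ (k : ℕ) (c : Fin (k + 3) → ZMod 2) :
    walsh (k + 3) (f0 (k + 3)) c
      = walsh (k + 2) (f0 (k + 2)) (Fin.init c)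
        + (-1 : ℤ) ^ (c (Fin.last _)).val * walsh (k + 2) (f2 (k + 2)) (Fin.init c) := by
  rw [walsh_succ, Finset.sum_add_distrib, ← Finset.mul_sum]
  simp only [walsh, f0, tm_snoc, f2_add_two, mul_zero, add_zero, mul_one]

theorem walsh_f2_succ (k : ℕ) (c : Fin (k + 3) → ZMod 2) :
    walsh (k + 3) (f2 (k + 3)) c
      = walsh (k + 2) (f0 (k + 2)) (Fin.init c)
        + (-1 : ℤ) ^ (c (Fin.last _)).val
          * walsh (k + 2) (f2 (k + 2)) (Fin.init c + eLast (k + 2)) := by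
  rw [walsh_succ, Finset.sum_add_distrib, ← Finset.mul_sum]
  simp only [f2_snoc]
  simp only [walsh, f0, f2_add_two, dotp_add_eLast, mul_zero, add_zero, mul_one]
  congr 2
  refine Finset.sum_congr rfl fun y _ => ?_
  rw [add_right_comm, add_assoc _ (dotp _ _ _)]
  rfl

theorem walsh_f2_add_eLast_succ (k : ℕ) (c : Fin (k + 3) → ZMod 2) :
    walsh (k + 3) (f2 (k + 3)) (c + eLast (k + 3))
      = walsh (k + 2) (f0 (k + 2)) (Fin.init c)
        - (-1 : ℤ) ^ (c (Fin.last _)).val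
          * walsh (k + 2) (f2 (k + 2)) (Fin.init c + eLast (k + 2)) := by
  have flip : ∀ a : ZMod 2, (-1 : ℤ) ^ (a + 1).val = -(-1 : ℤ) ^ a.val := by decide
  have init_eq : Fin.init (c + eLast (k + 3)) = Fin.init c := by
    funext i
    have : (i : ℕ) ≠ k + 2 := i.isLt.ne
    simp [Fin.init, eLast, this]
  have last_eq : (c + eLast (k + 3)) (Fin.last _) = c (Fin.last _) + 1 := by
    simp [eLast]
  rw [walsh_f2_succ, init_eq, last_eq, flip]
  ring

theorem walsh_f0_trunc_succ {n : ℕ} (k : ℕ) (h : k + 3 ≤ n) (c : Fin n → ZMod 2) :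
    walsh (k + 3) (f0 (k + 3)) (trunc (k + 3) h c)
      = walsh (k + 2) (f0 (k + 2)) (trunc (k + 2) (by omega) c)
        + (-1 : ℤ) ^ (c ⟨k + 2, h⟩).val
          * walsh (k + 2) (f2 (k + 2)) (trunc (k + 2) (by omega) c) :=
  walsh_f0_succ k _

theorem walsh_f2_trunc_succ {n : ℕ} (k : ℕ) (h : k + 3 ≤ n) (c : Fin n → ZMod 2) :
    walsh (k + 3) (f2 (k + 3)) (trunc (k + 3) h c)
      = walsh (k + 2) (f0 (k + 2)) (trunc (k + 2) (by omega) c)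
        + (-1 : ℤ) ^ (c ⟨k + 2, h⟩).val
          * walsh (k + 2) (f2 (k + 2)) (trunc (k + 2) (by omega) c + eLast (k + 2)) :=
  walsh_f2_succ k _

theorem walsh_f2_trunc_add_eLast_succ {n : ℕ} (k : ℕ) (h : k + 3 ≤ n) (c : Fin n → ZMod 2) :
    walsh (k + 3) (f2 (k + 3)) (trunc (k + 3) h c + eLast (k + 3))
      = walsh (k + 2) (f0 (k + 2)) (trunc (k + 2) (by omega) c)
        - (-1 : ℤ) ^ (c ⟨k + 2, h⟩).val
          * walsh (k + 2) (f2 (k + 2)) (trunc (k + 2) (by omega) c + eLast (k + 2)) :=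
  walsh_f2_add_eLast_succ k _

/-- For every `n ≥ 8` and `c ∈ F_2^n` with `c_{n−1} = 1`, the three-case
recurrence for `f̂_2^n(c)` in terms of `f̂_0^{n−1}, f̂_0^{n−4}, f̂_0^{n−5}, f̂_2^{n−5}`. -/
theorem stmt_11 (n : ℕ) (hn : 8 ≤ n) (c : Fin n → ZMod 2)
    (hc : c ⟨n - 1, by omega⟩ = 1) :
    (c ⟨n - 2, by omega⟩ = 0 →
      walsh n (f2 n) c
        = walsh (n - 1) (f0 (n - 1)) (trunc (n - 1) (by omega) c)
          - 2 * (-1 : ℤ) ^ (c ⟨n - 3, by omega⟩).val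
              * walsh (n - 4) (f0 (n - 4)) (trunc (n - 4) (by omega) c))
    ∧ (c ⟨n - 2, by omega⟩ = 1 → c ⟨n - 3, by omega⟩ = 0 →
      walsh n (f2 n) c
        = walsh (n - 1) (f0 (n - 1)) (trunc (n - 1) (by omega) c)
          - 2 * walsh (n - 4) (f0 (n - 4)) (trunc (n - 4) (by omega) c)
          - 4 * (-1 : ℤ) ^ (c ⟨n - 4, by omega⟩).val
              * walsh (n - 5) (f0 (n - 5)) (trunc (n - 5) (by omega) c))
    ∧ (c ⟨n - 2, by omega⟩ = 1 → c ⟨n - 3, by omega⟩ = 1 →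
      walsh n (f2 n) c
        = walsh (n - 1) (f0 (n - 1)) (trunc (n - 1) (by omega) c)
          - 2 * walsh (n - 4) (f0 (n - 4)) (trunc (n - 4) (by omega) c)
          - 4 * (-1 : ℤ) ^ (c ⟨n - 4, by omega⟩ + c ⟨n - 5, by omega⟩).val
              * walsh (n - 5) (f2 (n - 5))
                  (trunc (n - 5) (by omega) c + eLast (n - 5))) := by
  obtain ⟨k, rfl⟩ : ∃ k, n = k + 7 := ⟨n - 7, by omega⟩
  have sign_add : ∀ a b : ZMod 2, (-1 : ℤ) ^ (a + b).val = (-1) ^ a.val * (-1) ^ b.val := by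
    decide
  have sign_zero : (-1 : ℤ) ^ (0 : ZMod 2).val = 1 := rfl
  have sign_one : (-1 : ℤ) ^ (1 : ZMod 2).val = -1 := rfl
  have B7 := walsh_f2_trunc_succ (k + 4) le_rfl c
  have D6 := walsh_f2_trunc_add_eLast_succ (k + 3) (by omega) c
  have D5 := walsh_f2_trunc_add_eLast_succ (k + 2) (by omega) c
  have A5 := walsh_f0_trunc_succ (k + 2) (by omega) c
  have D4 := walsh_f2_trunc_add_eLast_succ (k + 1) (by omega) c
  have A4 := walsh_f0_trunc_succ (k + 1) (by omega) c
  have B4 := walsh_f2_trunc_succ (k + 1) (by omega) c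
  have D3 := walsh_f2_trunc_add_eLast_succ k (by omega) c
  have B3 := walsh_f2_trunc_succ k (by omega) c
  change walsh (k + 7) (f2 (k + 7)) c = _ at B7
  change c ⟨k + 6, _⟩ = 1 at hc
  simp only [Nat.add_assoc, Nat.reduceAdd, hc, sign_one] at B7 D6 D5 A5 D4 A4 B4
  refine ⟨fun h5 => ?_, fun h5 h4 => ?_, fun h5 h4 => ?_⟩
  · change c ⟨k + 5, _⟩ = 0 at h5
    change _ = walsh (k + 6) (f0 (k + 6)) (trunc (k + 6) _ c)
      - 2 * (-1 : ℤ) ^ (c ⟨k + 4, _⟩).val * walsh (k + 3) (f0 (k + 3)) (trunc (k + 3) _ c)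
    rw [B7, D6, h5, sign_zero, D5, A5, B4, D4]
    ring
  · change c ⟨k + 5, _⟩ = 1 at h5
    change c ⟨k + 4, _⟩ = 0 at h4
    change _ = walsh (k + 6) (f0 (k + 6)) (trunc (k + 6) _ c)
      - 2 * walsh (k + 3) (f0 (k + 3)) (trunc (k + 3) _ c)
      - 4 * (-1 : ℤ) ^ (c ⟨k + 3, _⟩).val * walsh (k + 2) (f0 (k + 2)) (trunc (k + 2) _ c)
    rw [B7, D6, h5, sign_one, D5, A5, A4, B4, D4, h4, sign_zero, B3, D3]
    ring
  · change c ⟨k + 5, _⟩ = 1 at h5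
    change c ⟨k + 4, _⟩ = 1 at h4
    change _ = walsh (k + 6) (f0 (k + 6)) (trunc (k + 6) _ c)
      - 2 * walsh (k + 3) (f0 (k + 3)) (trunc (k + 3) _ c)
      - 4 * (-1 : ℤ) ^ (c ⟨k + 3, _⟩ + c ⟨k + 2, _⟩).val
        * walsh (k + 2) (f2 (k + 2)) (trunc (k + 2) _ c + eLast (k + 2))
    rw [B7, D6, h5, sign_one, D5, A5, A4, B4, D4, h4, sign_one, B3, D3, sign_add]
    ring
end

section
/- For every n ≥ 8 and every c = (c_0,…,c_{n−1}) ∈ F_2^n with c_{n−1} = 1: if c_{n−2} = 1 then f̂_1^n(c) = f̂_1^{n−1}(c^{n−1}) − 2(−1)^{c_{n−3}} f̂_1^{n−4}(c^{n−4}); if c_{n−2} = 0 and c_{n−3} = 0 then f̂_1^n(c) = f̂_1^{n−1}(c^{n−1}) − 2 f̂_1^{n−4}(c^{n−4}) − 4(−1)^{c_{n−4}} f̂_1^{n−5}(c^{n−5}); if c_{n−2} = 0 and c_{n−3} = 1 then f̂_1^n(c) = f̂_1^{n−1}(c^{n−1}) − 2 f̂_1^{n−4}(c^{n−4}) − 4(−1)^{c_{n−4}+c_{n−5}}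 f̂_3^{n−5}(c^{n−5} + e_1). -/
/-- Append a last coordinate to a vector of `F_2^m`. -/
def snocVec {m : ℕ} (y : Fin m → ZMod 2) (v : ZMod 2) : Fin (m + 1) → ZMod 2 :=
  Fin.snoc (α := fun _ => ZMod 2) y v

lemma snocVec_last {m : ℕ} (y : Fin m → ZMod 2) (v : ZMod 2) (h : m < m + 1) :
    snocVec y v ⟨m, h⟩ = v :=
  Fin.snoc_last (α := fun _ => ZMod 2) v y

lemma snocVec_of_lt {m : ℕ} (y : Fin m → ZMod 2) (v : ZMod 2) {i : ℕ} (h : i < m)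
    (h' : i < m + 1) : snocVec y v ⟨i, h'⟩ = y ⟨i, h⟩ :=
  Fin.snoc_castSucc (α := fun _ => ZMod 2) v y ⟨i, h⟩

lemma sum_snocVec {M : Type*} [AddCommMonoid M] {m : ℕ} (F : (Fin (m + 1) → ZMod 2) → M) :
    ∑ x, F x = ∑ y : Fin m → ZMod 2, ∑ v : ZMod 2, F (snocVec y v) := by
  rw [Finset.sum_comm, ← Fintype.sum_prod_type']
  exact ((Fin.snocEquiv (fun _ => ZMod 2)).sum_comp F).symm

lemma tm_snocVec (k : ℕ) (w : Fin (k + 2) → ZMod 2) (v : ZMod 2) :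
    tm (k + 3) (snocVec w v)
      = tm (k + 2) w + w ⟨k, by omega⟩ * w ⟨k + 1, by omega⟩ * v := by
  unfold tm
  rw [Finset.sum_range_succ, Finset.sum_range_succ, Finset.sum_range_succ,
    Finset.sum_range_succ _ (k + 1), Finset.sum_range_succ _ k]
  rw [dif_pos (show k + 2 < k + 3 by omega), dif_neg (show ¬ k + 2 < k + 2 by omega),
    dif_neg (show ¬ k + 1 + 2 < k + 3 by omega), dif_neg (show ¬ k + 1 + 2 < k + 2 by omega),
    dif_neg (show ¬ k + 2 + 2 < k + 3 by omega), snocVec_of_lt w v (i := k) (by omega),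
    snocVec_of_lt w v (i := k + 1) (by omega), snocVec_last]
  simp only [add_zero]
  congr 1
  refine Finset.sum_congr rfl fun i hi => ?_
  rw [Finset.mem_range] at hi
  rw [dif_pos (by omega), dif_pos (by omega), snocVec_of_lt w v (i := i) (by omega),
    snocVec_of_lt w v (i := i + 1) (by omega), snocVec_of_lt w v (i := i + 2) (by omega)]

lemma f1_snocVec (k : ℕ) (y : Fin k → ZMod 2) (a b v : ZMod 2) :
    f1 (k + 3) (snocVec (snocVec (snocVec y a) b) v)
      = f1 (k + 2) (snocVec (snocVec y a) b) + a * b * v := by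
  unfold f1
  rw [dif_pos (by omega), dif_pos (by omega), tm_snocVec, snocVec_last,
    snocVec_of_lt _ b (i := k) (by omega), snocVec_last,
    snocVec_of_lt _ v (i := 0) (by omega), snocVec_of_lt _ v (i := 1) (by omega)]
  ring

lemma f3_snocVec (k : ℕ) (y : Fin k → ZMod 2) (a b : ZMod 2) :
    f3 (k + 2) (snocVec (snocVec y a) b)
      = f1 (k + 2) (snocVec (snocVec y a) b) + a * b
        + snocVec (snocVec y a) b ⟨0, by omega⟩ + b := by
  unfold f1 f3
  rw [dif_pos (by omega), dif_pos (by omega)]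
  simp only [Nat.add_sub_cancel, show k + 2 - 1 = k + 1 from rfl]
  rw [snocVec_last, snocVec_of_lt _ b (i := k) (by omega), snocVec_last]

lemma dotp_trunc_snocVec {n m : ℕ} (h : m + 1 ≤ n) (c : Fin n → ZMod 2)
    (y : Fin m → ZMod 2) (v : ZMod 2) :
    dotp (m + 1) (trunc (m + 1) h c) (snocVec y v)
      = dotp m (trunc m (Nat.le_of_succ_le h) c) y + c ⟨m, h⟩ * v := by
  unfold dotp
  rw [Fin.sum_univ_castSucc]
  congr 1
  · refine Finset.sum_congr rfl fun i _ => ?_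
    rw [show snocVec y v i.castSucc = y i from snocVec_of_lt y v i.2 _]
    rfl
  · rw [show snocVec y v (Fin.last m) = v from snocVec_last y v _]
    rfl

lemma dotp_add_eOne (m : ℕ) (c x : Fin (m + 1) → ZMod 2) :
    dotp (m + 1) (c + eOne (m + 1)) x = dotp (m + 1) c x + x ⟨0, by omega⟩ := by
  unfold dotp
  simp only [Pi.add_apply, add_mul, Finset.sum_add_distrib]
  congr 1
  rw [Fin.sum_univ_succ]
  simp [eOne]

/-- The Fourier transform of `f_1`, with the last two variables split off. -/
lemma walsh_f1_trunc {n k : ℕ} (h : k + 2 ≤ n) (c : Fin n → ZMod 2) :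
    walsh (k + 2) (f1 (k + 2)) (trunc (k + 2) h c)
      = ∑ y : Fin k → ZMod 2, ∑ s : ZMod 2, ∑ t : ZMod 2,
          (-1 : ℤ) ^ (f1 (k + 2) (snocVec (snocVec y s) t)
            + dotp (k + 2) (trunc (k + 2) h c) (snocVec (snocVec y s) t)).val := by
  unfold walsh
  rw [sum_snocVec, sum_snocVec]

lemma walsh_f3_trunc_add_eOne {n k : ℕ} (h : k + 2 ≤ n) (c : Fin n → ZMod 2) :
    walsh (k + 2) (f3 (k + 2)) (trunc (k + 2) h c + eOne (k + 2))
      = ∑ y : Fin k → ZMod 2, ∑ s : ZMod 2, ∑ t : ZMod 2,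
          (-1 : ℤ) ^ (f1 (k + 2) (snocVec (snocVec y s) t)
            + dotp (k + 2) (trunc (k + 2) h c) (snocVec (snocVec y s) t)
            + (s * t + t)).val := by
  unfold walsh
  rw [sum_snocVec, sum_snocVec]
  refine Finset.sum_congr rfl fun y _ => Finset.sum_congr rfl fun s _ =>
    Finset.sum_congr rfl fun t _ => ?_
  rw [f3_snocVec, dotp_add_eOne]
  congr 2
  linear_combination CharTwo.add_self_eq_zero (snocVec (snocVec y s) t ⟨0, by omega⟩)

lemma walsh_f1_trunc_add_three {n k : ℕ} (h : k + 3 ≤ n) (c : Fin n → ZMod 2) :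
    walsh (k + 3) (f1 (k + 3)) (trunc (k + 3) h c)
      = ∑ y : Fin k → ZMod 2, ∑ s : ZMod 2, ∑ t : ZMod 2, ∑ q : ZMod 2,
          (-1 : ℤ) ^ (f1 (k + 2) (snocVec (snocVec y s) t)
            + dotp (k + 2) (trunc (k + 2) (by omega) c) (snocVec (snocVec y s) t)
            + (s * t + c ⟨k + 2, h⟩) * q).val := by
  rw [walsh_f1_trunc (k := k + 1) h, sum_snocVec]
  refine Finset.sum_congr rfl fun y _ => Finset.sum_congr rfl fun s _ =>
    Finset.sum_congr rfl fun t _ => Finset.sum_congr rfl fun q _ => ?_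
  rw [f1_snocVec, dotp_trunc_snocVec]
  congr 2
  ring

lemma walsh_f1_trunc_add_six {n k : ℕ} (h : k + 6 ≤ n) (c : Fin n → ZMod 2) :
    walsh (k + 6) (f1 (k + 6)) (trunc (k + 6) h c)
      = ∑ y : Fin k → ZMod 2, ∑ s : ZMod 2, ∑ t : ZMod 2, ∑ q : ZMod 2,
          ∑ r : ZMod 2, ∑ a : ZMod 2, ∑ b : ZMod 2,
          (-1 : ℤ) ^ (f1 (k + 2) (snocVec (snocVec y s) t)
            + dotp (k + 2) (trunc (k + 2) (by omega) c) (snocVec (snocVec y s) t)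
            + ((s * t + c ⟨k + 2, by omega⟩) * q + (t * q + c ⟨k + 3, by omega⟩) * r
              + (q * r + c ⟨k + 4, by omega⟩) * a + (r * a + c ⟨k + 5, h⟩) * b)).val := by
  rw [walsh_f1_trunc_add_three (k := k + 3) h, sum_snocVec, sum_snocVec, sum_snocVec]
  refine Finset.sum_congr rfl fun y _ => Finset.sum_congr rfl fun s _ =>
    Finset.sum_congr rfl fun t _ => Finset.sum_congr rfl fun q _ =>
    Finset.sum_congr rfl fun r _ => Finset.sum_congr rfl fun a _ =>
    Finset.sum_congr rfl fun b _ => ?_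
  rw [f1_snocVec, dotp_trunc_snocVec, f1_snocVec, dotp_trunc_snocVec, f1_snocVec,
    dotp_trunc_snocVec]
  congr 2
  ring

lemma walsh_f1_trunc_add_seven {n k : ℕ} (h : k + 7 ≤ n) (c : Fin n → ZMod 2) :
    walsh (k + 7) (f1 (k + 7)) (trunc (k + 7) h c)
      = ∑ y : Fin k → ZMod 2, ∑ s : ZMod 2, ∑ t : ZMod 2, ∑ q : ZMod 2,
          ∑ r : ZMod 2, ∑ a : ZMod 2, ∑ b : ZMod 2, ∑ v : ZMod 2,
          (-1 : ℤ) ^ (f1 (k + 2) (snocVec (snocVec y s) t)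
            + dotp (k + 2) (trunc (k + 2) (by omega) c) (snocVec (snocVec y s) t)
            + ((s * t + c ⟨k + 2, by omega⟩) * q + (t * q + c ⟨k + 3, by omega⟩) * r
              + (q * r + c ⟨k + 4, by omega⟩) * a + (r * a + c ⟨k + 5, by omega⟩) * b
              + (a * b + c ⟨k + 6, h⟩) * v)).val := by
  rw [walsh_f1_trunc_add_six (k := k + 1) h, sum_snocVec]
  refine Finset.sum_congr rfl fun y _ => Finset.sum_congr rfl fun s _ =>
    Finset.sum_congr rfl fun t _ => Finset.sum_congr rfl fun q _ =>
    Finset.sum_congr rfl fun r _ => Finset.sum_congr rfl fun a _ =>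
    Finset.sum_congr rfl fun b _ => Finset.sum_congr rfl fun v _ => ?_
  rw [f1_snocVec, dotp_trunc_snocVec]
  congr 2
  ring

lemma sum_sign_sub_sum_sign (z r a d : ZMod 2) :
    (∑ b : ZMod 2, ∑ v : ZMod 2, (-1 : ℤ) ^ (z + ((r * a + d) * b + (a * b + 1) * v)).val)
      - ∑ b : ZMod 2, (-1 : ℤ) ^ (z + (r * a + d) * b).val
      = if (r + 1) * a = d then -2 * (-1 : ℤ) ^ z.val else 0 := by
  revert z r a d
  decide

/-- If `c_{n-1} = 1`, the difference of the transforms of `f_1` in `n` and `n - 1` variables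
only involves the points where summation over the last two variables does not cancel. -/
lemma walsh_f1_trunc_sub {n k : ℕ} (h : k + 7 ≤ n) (c : Fin n → ZMod 2)
    (hc : c ⟨k + 6, h⟩ = 1) :
    walsh (k + 7) (f1 (k + 7)) (trunc (k + 7) h c)
        - walsh (k + 6) (f1 (k + 6)) (trunc (k + 6) (by omega) c)
      = ∑ y : Fin k → ZMod 2, ∑ s : ZMod 2, ∑ t : ZMod 2, ∑ q : ZMod 2,
          ∑ r : ZMod 2, ∑ a : ZMod 2,
          if (r + 1) * a = c ⟨k + 5, by omega⟩ then
            -2 * (-1 : ℤ) ^ (f1 (k + 2) (snocVec (snocVec y s) t)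
              + dotp (k + 2) (trunc (k + 2) (by omega) c) (snocVec (snocVec y s) t)
              + ((s * t + c ⟨k + 2, by omega⟩) * q + (t * q + c ⟨k + 3, by omega⟩) * r
                + (q * r + c ⟨k + 4, by omega⟩) * a)).val
          else 0 := by
  rw [walsh_f1_trunc_add_seven, walsh_f1_trunc_add_six]
  simp only [← Finset.sum_sub_distrib _ _, hc]
  refine Finset.sum_congr rfl fun y _ => Finset.sum_congr rfl fun s _ =>
    Finset.sum_congr rfl fun t _ => Finset.sum_congr rfl fun q _ =>
    Finset.sum_congr rfl fun r _ => Finset.sum_congr rfl fun a _ => ?_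
  rw [← sum_sign_sub_sum_sign, ← Finset.sum_sub_distrib]
  simp only [add_assoc]

/-- For every `n ≥ 8` and `c ∈ F_2^n` with `c_{n−1} = 1`, the three-case
recurrence for `f̂_1^n(c)` in terms of `f̂_1^{n−1}, f̂_1^{n−4}, f̂_1^{n−5}, f̂_3^{n−5}`. -/
theorem stmt_12 (n : ℕ) (hn : 8 ≤ n) (c : Fin n → ZMod 2)
    (hc : c ⟨n - 1, by omega⟩ = 1) :
    (c ⟨n - 2, by omega⟩ = 1 →
      walsh n (f1 n) c
        = walsh (n - 1) (f1 (n - 1)) (trunc (n - 1) (by omega) c)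
          - 2 * (-1 : ℤ) ^ (c ⟨n - 3, by omega⟩).val
              * walsh (n - 4) (f1 (n - 4)) (trunc (n - 4) (by omega) c))
    ∧ (c ⟨n - 2, by omega⟩ = 0 → c ⟨n - 3, by omega⟩ = 0 →
      walsh n (f1 n) c
        = walsh (n - 1) (f1 (n - 1)) (trunc (n - 1) (by omega) c)
          - 2 * walsh (n - 4) (f1 (n - 4)) (trunc (n - 4) (by omega) c)
          - 4 * (-1 : ℤ) ^ (c ⟨n - 4, by omega⟩).val
              * walsh (n - 5) (f1 (n - 5)) (trunc (n - 5) (by omega) c))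
    ∧ (c ⟨n - 2, by omega⟩ = 0 → c ⟨n - 3, by omega⟩ = 1 →
      walsh n (f1 n) c
        = walsh (n - 1) (f1 (n - 1)) (trunc (n - 1) (by omega) c)
          - 2 * walsh (n - 4) (f1 (n - 4)) (trunc (n - 4) (by omega) c)
          - 4 * (-1 : ℤ) ^ (c ⟨n - 4, by omega⟩ + c ⟨n - 5, by omega⟩).val
              * walsh (n - 5) (f3 (n - 5))
                  (trunc (n - 5) (by omega) c + eOne (n - 5))) := by
  obtain ⟨k, rfl⟩ : ∃ k, n = k + 7 := ⟨n - 7, by omega⟩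
  have H := walsh_f1_trunc_sub (k := k) le_rfl c hc
  have H3 := walsh_f1_trunc_add_three (k := k) (by omega) c
  have H2 := walsh_f1_trunc (k := k) (by omega) c
  have H3' := walsh_f3_trunc_add_eOne (k := k) (by omega) c
  refine ⟨fun h5 => ?_, fun h5 h4 => ?_, fun h5 h4 => ?_⟩
  · change c ⟨k + 5, by omega⟩ = 1 at h5
    refine (sub_eq_iff_eq_add'.1 (H.trans ?_)).trans (sub_eq_add_neg _ _).symm
    refine Eq.trans ?_ (congrArg (fun A : ℤ => -(2 * (-1 : ℤ) ^
      (c ⟨k + 4, by omega⟩).val * A)) H3).symm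
    simp only [Finset.mul_sum, ← Finset.sum_neg_distrib, h5]
    refine Finset.sum_congr rfl fun y _ => Finset.sum_congr rfl fun s _ =>
      Finset.sum_congr rfl fun t _ => ?_
    generalize f1 (k + 2) _ + dotp (k + 2) _ _ = g
    generalize c ⟨k + 2, _⟩ = c2
    generalize c ⟨k + 3, _⟩ = c3
    generalize c ⟨k + 4, _⟩ = c4
    revert g s t c2 c3 c4
    decide +kernel
  · change c ⟨k + 5, by omega⟩ = 0 at h5
    change c ⟨k + 4, by omega⟩ = 0 at h4
    refine (sub_eq_iff_eq_add'.1 (H.trans ?_)).trans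
      ((sub_sub _ _ _).trans (sub_eq_add_neg _ _)).symm
    refine Eq.trans ?_ (congrArg₂ (fun A B : ℤ => -(2 * A + 4 * (-1 : ℤ) ^
      (c ⟨k + 3, by omega⟩).val * B)) H3 H2).symm
    simp only [Finset.mul_sum, ← Finset.sum_add_distrib, ← Finset.sum_neg_distrib, h5, h4]
    refine Finset.sum_congr rfl fun y _ => Finset.sum_congr rfl fun s _ =>
      Finset.sum_congr rfl fun t _ => ?_
    generalize f1 (k + 2) _ + dotp (k + 2) _ _ = g
    generalize c ⟨k + 2, _⟩ = c2
    generalize c ⟨k + 3, _⟩ = c3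
    revert g s t c2 c3
    decide +kernel
  · change c ⟨k + 5, by omega⟩ = 0 at h5
    change c ⟨k + 4, by omega⟩ = 1 at h4
    refine (sub_eq_iff_eq_add'.1 (H.trans ?_)).trans
      ((sub_sub _ _ _).trans (sub_eq_add_neg _ _)).symm
    refine Eq.trans ?_ (congrArg₂ (fun A B : ℤ => -(2 * A + 4 * (-1 : ℤ) ^
      (c ⟨k + 3, by omega⟩ + c ⟨k + 2, by omega⟩).val * B)) H3 H3').symm
    simp only [Finset.mul_sum, ← Finset.sum_add_distrib, ← Finset.sum_neg_distrib, h5, h4]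
    refine Finset.sum_congr rfl fun y _ => Finset.sum_congr rfl fun s _ =>
      Finset.sum_congr rfl fun t _ => ?_
    generalize f1 (k + 2) _ + dotp (k + 2) _ _ = g
    generalize c ⟨k + 2, _⟩ = c2
    generalize c ⟨k + 3, _⟩ = c3
    revert g s t c2 c3
    decide +kernel
end

section
/- For every n ≥ 8, F̂_3^n(0) = F̂_3^{n−1}(0) + 2·F̂_3^{n−4}(0) + 4·F̂_3^{n−5}(0), where 0 denotes the zero vector of the appropriate dimension. -/
/-- The sum of `x_i x_{i+1} x_{i+2}` along the word `a, b, y_0, …, y_{n-1}, p, q`. -/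
def cubicPath : (n : ℕ) → (Fin n → ZMod 2) → (a b p q : ZMod 2) → ZMod 2
  | 0, _, a, b, p, q => a * b * p + b * p * q
  | n + 1, y, a, b, p, q => a * b * y 0 + cubicPath n (Fin.tail y) b (y 0) p q

theorem cubicPath_eq_sum (n : ℕ) (X : ℕ → ZMod 2) :
    cubicPath n (fun i => X (i + 2)) (X 0) (X 1) (X (n + 2)) (X (n + 3))
      = ∑ i ∈ Finset.range (n + 2), X i * X (i + 1) * X (i + 2) := by
  induction n generalizing X with
  | zero => simp [cubicPath, Finset.sum_range_succ]
  | succ n ih =>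
    rw [Finset.sum_range_succ', ← ih fun i => X (i + 1)]
    exact add_comm _ _

/-- The character sum of `cubicPath` over all inner words. -/
def cubicPathSum (n : ℕ) (a b p q : ZMod 2) : ℤ :=
  ∑ y : Fin n → ZMod 2, (-1 : ℤ) ^ (cubicPath n y a b p q).val

theorem neg_one_pow_val_add_s15 (u v : ZMod 2) :
    (-1 : ℤ) ^ (u + v).val = (-1) ^ u.val * (-1) ^ v.val := by
  revert u v
  decide

theorem sum_fin_succ_fun (n : ℕ) (f : (Fin (n + 1) → ZMod 2) → ℤ) :
    ∑ x, f x = ∑ a, ∑ y : Fin n → ZMod 2, f (Fin.cons a y) := by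
  rw [← Fintype.sum_prod_type', ← (Fin.consEquiv fun _ => ZMod 2).sum_comp f]
  rfl

theorem cubicPathSum_succ (n : ℕ) (a b p q : ZMod 2) :
    cubicPathSum (n + 1) a b p q
      = ∑ c, (-1 : ℤ) ^ (a * b * c).val * cubicPathSum n b c p q := by
  simp only [cubicPathSum, sum_fin_succ_fun, cubicPath, neg_one_pow_val_add_s15, Fin.cons_zero,
    Fin.tail_cons, Finset.mul_sum]

theorem cubicPathSum_recurrence (n : ℕ) (a b p q : ZMod 2) :
    cubicPathSum (n + 6) a b p q
      = cubicPathSum (n + 5) a b p q + 2 * cubicPathSum (n + 2) a b p q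
        + 4 * cubicPathSum (n + 1) a b p q := by
  have expand (m : ℕ) (a b : ZMod 2) : cubicPathSum (m + 1) a b p q
      = cubicPathSum m b 0 p q + (-1) ^ (a * b).val * cubicPathSum m b 1 p q := by
    rw [cubicPathSum_succ]
    change ∑ c : Fin 2, _ = _
    rw [Fin.sum_univ_two]
    change (-1) ^ (a * b * 0).val * cubicPathSum m b 0 p q
      + (-1) ^ (a * b * 1).val * cubicPathSum m b 1 p q = _
    simp
  have e00 (m : ℕ) := expand m 0 0
  have e01 (m : ℕ) := expand m 0 1
  have e10 (m : ℕ) := expand m 1 0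
  have e11 (m : ℕ) := expand m 1 1
  have zero_or_one (c : ZMod 2) : c = 0 ∨ c = 1 := by revert c; decide
  simp only [mul_zero, mul_one, ZMod.val_zero, ZMod.val_one, pow_zero, pow_one,
    one_mul] at e00 e01 e10 e11
  rcases zero_or_one a with rfl | rfl <;> rcases zero_or_one b with rfl | rfl <;>
    · simp only [e00, e01, e10, e11]
      ring

theorem F3_eq_cubicPath (n : ℕ) (a b : ZMod 2) (y : Fin n → ZMod 2) :
    F3 (n + 2) (Fin.cons a (Fin.cons b y : Fin (n + 1) → ZMod 2)) = cubicPath n y a b a b := by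
  set x : Fin (n + 2) → ZMod 2 := Fin.cons a (Fin.cons b y : Fin (n + 1) → ZMod 2)
  let X : ℕ → ZMod 2 := fun i => x ⟨i % (n + 2), Nat.mod_lt _ (by omega)⟩
  have X_eq (i j : ℕ) (hj : j < n + 2) (h : i % (n + 2) = j) : X i = x ⟨j, hj⟩ := by
    subst h; rfl
  have h0 : X 0 = a := (X_eq 0 0 (by omega) (Nat.zero_mod _)).trans rfl
  have h1 : X 1 = b := (X_eq 1 1 (by omega) (Nat.mod_eq_of_lt (by omega))).trans rfl
  have h2 : X (n + 2) = a := (X_eq (n + 2) 0 (by omega) (Nat.mod_self _)).trans rfl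
  have h3 : X (n + 3) = b := by
    refine (X_eq (n + 3) 1 (by omega) ?_).trans rfl
    rw [show n + 3 = 1 + (n + 2) by omega, Nat.add_mod_right, Nat.mod_eq_of_lt (by omega)]
  have hy : (fun i : Fin n => X (i + 2)) = y := by
    funext i
    exact X_eq _ (i + 2) (by omega) (Nat.mod_eq_of_lt (by omega))
  have key := cubicPath_eq_sum n X
  rw [h0, h1, h2, h3, hy] at key
  rw [key, Finset.sum_range, F3]
  refine Finset.sum_congr rfl fun i _ => ?_
  rw [X_eq i i i.isLt (Nat.mod_eq_of_lt i.isLt)]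

theorem walsh_F3_zero (n : ℕ) :
    walsh (n + 2) (F3 (n + 2)) 0 = ∑ a, ∑ b, cubicPathSum n a b a b := by
  simp only [walsh, dotp, Pi.zero_apply, zero_mul, Finset.sum_const_zero, add_zero,
    sum_fin_succ_fun, F3_eq_cubicPath, cubicPathSum]

/-- For every `n ≥ 8`,
`F̂_3^n(0) = F̂_3^{n−1}(0) + 2 F̂_3^{n−4}(0) + 4 F̂_3^{n−5}(0)`. -/
theorem stmt_15 (n : ℕ) (hn : 8 ≤ n) :
    walsh n (F3 n) 0
      = walsh (n - 1) (F3 (n - 1)) 0 + 2 * walsh (n - 4) (F3 (n - 4)) 0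
        + 4 * walsh (n - 5) (F3 (n - 5)) 0 := by
  obtain ⟨m, rfl⟩ := Nat.exists_eq_add_of_le' hn
  change walsh (m + 6 + 2) (F3 (m + 6 + 2)) 0
      = walsh (m + 5 + 2) (F3 (m + 5 + 2)) 0 + 2 * walsh (m + 2 + 2) (F3 (m + 2 + 2)) 0
        + 4 * walsh (m + 1 + 2) (F3 (m + 1 + 2)) 0
  simp only [walsh_F3_zero, cubicPathSum_recurrence, Finset.sum_add_distrib, Finset.mul_sum]
end
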